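/- Let l, m, n be positive integers and let A, B be partitions of length at most l with a_1 ≤ m and b_1 ≤ n. Then mD + χ(A) = (m−a_l,…,m−a_1) and nD + χ(B) = (n−b_l,…,n−b_1) are partitions, and for Schur polynomials in l variables one has s_{mD+χ(A)} · s_{nD+χ(B)} = Σ_C c^C_{A,B} · s_{(m+n)D+χ(C)}, where the sum runs over partitions C of length at most l with c_1 ≤ m+n and c^C_{A,B} are the Littlewood–Richardson coefficients. -/

import Mathlib

open Finset MvPolynomial

/-- `hp l k` is the complete homogeneous symmetric polynomial `h_k` in `l` variables,
interpreted as `0` for negative `k` (and `h_0 = 1`). -/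
noncomputable def hp (l : ℕ) (k : ℤ) : MvPolynomial (Fin l) ℤ :=
  if 0 ≤ k then MvPolynomial.hsymm (Fin l) ℤ k.toNat else 0

/-- The Schur polynomial of a partition (given as a weakly decreasing `l`-tuple) in `l`
variables, defined by the Jacobi–Trudi determinant `s_A = det (h_{A i - i + j})`. -/
noncomputable def schur (l : ℕ) (A : Fin l → ℕ) : MvPolynomial (Fin l) ℤ :=
  Matrix.det (Matrix.of fun i j : Fin l => hp l ((A i : ℤ) + (j : ℕ) - (i : ℕ)))

/-- The Vandermonde alternant `a_δ = det (x_i ^ (l - 1 - j))`. -/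
noncomputable def vdm (l : ℕ) : MvPolynomial (Fin l) ℤ :=
  Matrix.det (Matrix.of fun i j : Fin l => (X i : MvPolynomial (Fin l) ℤ) ^ (l - 1 - (j : ℕ)))

/-- The multiplicity (coefficient) of the Schur polynomial `s_B` in the expansion of a
symmetric polynomial `P` in the basis of Schur polynomials of partitions of length at most
`l`: it equals the coefficient of the monomial `x ^ (B + δ)` in the alternating polynomial
`P * a_δ`, where `δ = (l-1, l-2, …, 0)`. -/
noncomputable def schurMult (l : ℕ) (B : Fin l → ℕ) (P : MvPolynomial (Fin l) ℤ) : ℤ :=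
  MvPolynomial.coeff (Finsupp.equivFunOnFinite.symm fun i : Fin l => B i + (l - 1 - (i : ℕ)))
    (P * vdm l)

/-- The Littlewood–Richardson coefficient `c^C_{A,B}` for partitions of length at most `l`,
as the multiplicity of `s_C` in `s_A * s_B` (this agrees with the structure constants of the
ring of symmetric functions in the Schur basis). -/
noncomputable def lrCoeff (l : ℕ) (A B C : Fin l → ℕ) : ℤ :=
  schurMult l C (schur l A * schur l B)

/-- Dominance: every partial sum of `A` is at least the corresponding partial sum of `B`. -/
def Dom (l : ℕ) (A B : Fin l → ℕ) : Prop :=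
  ∀ r : ℕ, ∑ i ∈ Finset.univ.filter (fun i : Fin l => (i : ℕ) < r), B i ≤
    ∑ i ∈ Finset.univ.filter (fun i : Fin l => (i : ℕ) < r), A i

/-- The Young diagram of `A` (0-based): boxes `(i, j)` with `j < A i`. -/
def YD (l : ℕ) (A : Fin l → ℕ) : Set (Fin l × ℕ) := {p | p.2 < A p.1}

/-- The generating series of the complete homogeneous symmetric polynomials. -/
theorem coeff_geom_prod (l n : ℕ) :
    PowerSeries.coeff n (∏ i : Fin l,
      (PowerSeries.mk fun k => (X i : MvPolynomial (Fin l) ℤ) ^ k)) = hsymm (Fin l) ℤ n := by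
  classical
  rw [PowerSeries.coeff_prod, hsymm]
  symm
  refine Finset.sum_bij (fun s _ => Multiset.toFinsupp s.1) ?_ ?_ ?_ ?_
  · intro s _
    rw [Finset.mem_finsuppAntidiag]
    refine ⟨?_, Finset.subset_univ _⟩
    have h1 := Multiset.sum_count_eq_card (s := (Finset.univ : Finset (Fin l))) (m := s.1)
      (fun _ _ => Finset.mem_univ _)
    exact h1.trans s.2
  · intro s _ t _ h
    exact Subtype.ext (Multiset.toFinsupp.injective h)
  · intro f hf
    rw [Finset.mem_finsuppAntidiag] at hf
    refine ⟨⟨Finsupp.toMultiset f, ?_⟩, Finset.mem_univ _, ?_⟩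
    · rw [Finsupp.card_toMultiset, Finsupp.sum_fintype _ _ (fun _ => rfl)]
      exact hf.1
    · simp
  · intro s _
    simp only [PowerSeries.coeff_mk, Multiset.toFinsupp_apply]
    rw [Finset.prod_multiset_map_count]
    refine Finset.prod_subset (Finset.subset_univ _) ?_
    intro x _ hx
    rw [Multiset.mem_toFinset] at hx
    rw [Multiset.count_eq_zero_of_notMem hx, pow_zero]

/-- The generating polynomial of the signed elementary symmetric polynomials omitting `X k`. -/
noncomputable def elemOmit (l : ℕ) (k : Fin l) : Polynomial (MvPolynomial (Fin l) ℤ) :=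
  ∏ i ∈ Finset.univ.erase k, (1 - Polynomial.C (X i) * Polynomial.X)

theorem elemOmit_coeff_eq_zero (l : ℕ) (k : Fin l) (r : ℕ) (hr : l ≤ r) :
    (elemOmit l k).coeff r = 0 := by
  apply Polynomial.coeff_eq_zero_of_natDegree_lt
  have h1 : (elemOmit l k).natDegree ≤
      ∑ i ∈ Finset.univ.erase k,
        (1 - Polynomial.C (X i : MvPolynomial (Fin l) ℤ) * Polynomial.X).natDegree :=
    Polynomial.natDegree_prod_le _ _
  have h2 : ∑ i ∈ Finset.univ.erase k,
      (1 - Polynomial.C (X i : MvPolynomial (Fin l) ℤ) * Polynomial.X).natDegree ≤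
      ∑ i ∈ (Finset.univ : Finset (Fin l)).erase k, 1 := by
    refine Finset.sum_le_sum fun i _ => ?_
    compute_degree
  have h3 : ∑ i ∈ (Finset.univ : Finset (Fin l)).erase k, 1 = l - 1 := by simp
  have := k.2
  omega

theorem geom_mul (l : ℕ) (i : Fin l) :
    (PowerSeries.mk fun k => (X i : MvPolynomial (Fin l) ℤ) ^ k) *
      (1 - PowerSeries.C (X i) * PowerSeries.X) = 1 := by
  ext n : 1
  cases n with
  | zero => simp
  | succ n =>
    rw [mul_sub, ← mul_assoc, mul_one, map_sub, PowerSeries.coeff_succ_mul_X,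
      PowerSeries.coeff_mul_C]
    simp [PowerSeries.coeff_one, pow_succ]

theorem hser_mul_elemOmit (l : ℕ) (k : Fin l) :
    (∏ i : Fin l, (PowerSeries.mk fun k => (X i : MvPolynomial (Fin l) ℤ) ^ k)) *
      (elemOmit l k : PowerSeries (MvPolynomial (Fin l) ℤ)) =
      PowerSeries.mk fun n => (X k : MvPolynomial (Fin l) ℤ) ^ n := by
  have h : (elemOmit l k : PowerSeries (MvPolynomial (Fin l) ℤ)) =
      ∏ i ∈ Finset.univ.erase k, (1 - PowerSeries.C (X i) * PowerSeries.X) := by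
    unfold elemOmit
    rw [← Polynomial.coeToPowerSeries.ringHom_apply, map_prod]
    simp
  rw [h, ← Finset.mul_prod_erase _ _ (Finset.mem_univ k), mul_assoc, ← Finset.prod_mul_distrib,
    Finset.prod_congr rfl (fun i _ => geom_mul l i)]
  simp

theorem hp_elem_sum (l : ℕ) (k : Fin l) (p : ℕ) :
    ∑ r ∈ Finset.range l, hp l ((p : ℤ) - r) * (elemOmit l k).coeff r =
      (X k : MvPolynomial (Fin l) ℤ) ^ p := by
  have h := congrArg (PowerSeries.coeff p) (hser_mul_elemOmit l k)
  rw [PowerSeries.coeff_mk, mul_comm, PowerSeries.coeff_mul,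
    Finset.Nat.sum_antidiagonal_eq_sum_range_succ_mk] at h
  rw [← h]
  simp only [coeff_geom_prod, Polynomial.coeff_coe]
  have h1 : ∑ r ∈ Finset.range l, hp l ((p : ℤ) - r) * (elemOmit l k).coeff r =
      ∑ r ∈ Finset.range (l + p + 1), hp l ((p : ℤ) - r) * (elemOmit l k).coeff r := by
    refine Finset.sum_subset ?_ ?_
    · intro x hx
      rw [Finset.mem_range] at *
      omega
    · intro x _ hx
      rw [Finset.mem_range, not_lt] at hx
      rw [elemOmit_coeff_eq_zero l k x hx, mul_zero]
  have h2 : ∑ r ∈ Finset.range (p + 1), hp l ((p : ℤ) - r) * (elemOmit l k).coeff r =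
      ∑ r ∈ Finset.range (l + p + 1), hp l ((p : ℤ) - r) * (elemOmit l k).coeff r := by
    refine Finset.sum_subset ?_ ?_
    · intro x hx
      rw [Finset.mem_range] at *
      omega
    · intro x _ hx
      rw [Finset.mem_range, not_lt] at hx
      rw [hp, if_neg (by omega), zero_mul]
  rw [h1, ← h2]
  refine Finset.sum_congr rfl fun r hr => ?_
  rw [Finset.mem_range] at hr
  rw [hp, if_pos (by omega), mul_comm, show ((p : ℤ) - r).toNat = p - r by omega]

/-- The alternant `det (x_i ^ α_j)`. -/
noncomputable def alt (l : ℕ) (α : Fin l → ℕ) : MvPolynomial (Fin l) ℤ :=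
  Matrix.det (Matrix.of fun i j : Fin l => (X i : MvPolynomial (Fin l) ℤ) ^ α j)

theorem vdm_eq_alt (l : ℕ) : vdm l = alt l (fun j => l - 1 - (j : ℕ)) := rfl

noncomputable def elemMat (l : ℕ) : Matrix (Fin l) (Fin l) (MvPolynomial (Fin l) ℤ) :=
  Matrix.of fun j k => (elemOmit l k).coeff (l - 1 - (j : ℕ))

theorem schur_mul_elemMat (l : ℕ) (A : Fin l → ℕ) :
    schur l A * (elemMat l).det = alt l (fun j => A j + (l - 1 - (j : ℕ))) := by
  rw [schur, ← Matrix.det_mul, alt, ← Matrix.det_transpose]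
  congr 1
  ext1 i k
  rw [Matrix.transpose_apply, Matrix.mul_apply]
  simp only [Matrix.of_apply, elemMat]
  rw [← Equiv.sum_comp Fin.revPerm]
  rw [← hp_elem_sum l i (A k + (l - 1 - (k : ℕ))), Finset.sum_range]
  refine Finset.sum_congr rfl fun j _ => ?_
  have := j.2
  have := k.2
  have e1 : l - 1 - ((Fin.revPerm j : Fin l) : ℕ) = j := by
    simp [Fin.val_rev]; omega
  rw [e1]
  congr 2
  simp [Fin.val_rev]
  omega

theorem schur_zero (l : ℕ) : schur l (fun _ => 0) = 1 := by
  rw [schur, Matrix.det_of_isUpperTriangular]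
  · simp [hp]
  · intro i j hij
    have : (j : ℕ) < i := hij
    simp only [Matrix.of_apply]
    rw [hp, if_neg (by simp; omega)]

theorem schur_mul_vdm (l : ℕ) (A : Fin l → ℕ) :
    schur l A * vdm l = alt l (fun j => A j + (l - 1 - (j : ℕ))) := by
  have h0 := schur_mul_elemMat l (fun _ => 0)
  rw [schur_zero, one_mul] at h0
  rw [← schur_mul_elemMat, h0, vdm_eq_alt]
  simp

theorem alt_expand (l : ℕ) (α : Fin l → ℕ) :
    alt l α = ∑ σ : Equiv.Perm (Fin l), (Equiv.Perm.sign σ : ℤ) •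
      monomial (Finsupp.equivFunOnFinite.symm fun i => α (σ.symm i)) (1 : ℤ) := by
  rw [alt, Matrix.det_apply]
  refine Finset.sum_congr rfl fun σ _ => ?_
  have : ∏ i, (Matrix.of fun i j : Fin l => (X i : MvPolynomial (Fin l) ℤ) ^ α j) (σ i) i =
      monomial (Finsupp.equivFunOnFinite.symm fun i => α (σ.symm i)) (1 : ℤ) := by
    rw [monomial_eq, Finsupp.prod_fintype _ _ (fun _ => pow_zero _),
      ← Equiv.prod_comp σ (fun x => X x ^ _)]
    simp
  rw [this]
  rfl

theorem perm_eq_one_of_strictAnti (l : ℕ) (α γ : Fin l → ℕ) (hα : StrictAnti α)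
    (hγ : StrictAnti γ) (σ : Equiv.Perm (Fin l)) (h : ∀ i, α (σ.symm i) = γ i) :
    σ = 1 := by
  have hm : StrictMono σ.symm := by
    intro i j hij
    have := hγ hij
    rw [← h, ← h] at this
    exact hα.lt_iff_gt.1 this
  have : σ.symm = 1 := by
    have := Subsingleton.elim (hm.orderIsoOfSurjective _ σ.symm.surjective) (OrderIso.refl _)
    ext i
    exact congrArg Fin.val (DFunLike.congr_fun this i)
  ext i
  have h2 := DFunLike.congr_fun this (σ i)
  simp at h2
  simp [← h2]

theorem coeff_alt (l : ℕ) (α γ : Fin l → ℕ) (hα : StrictAnti α) (hγ : StrictAnti γ) :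
    coeff (Finsupp.equivFunOnFinite.symm γ) (alt l α) = if α = γ then 1 else 0 := by
  rw [alt_expand, coeff_sum, Finset.sum_eq_single 1]
  · simp only [Equiv.Perm.sign_one, Units.val_one, one_smul, coeff_monomial]
    refine if_congr ?_ rfl rfl
    rw [Equiv.apply_eq_iff_eq]
    exact Iff.rfl
  · intro σ _ hσ
    rw [coeff_smul, coeff_monomial, if_neg, smul_zero]
    intro h
    rw [Equiv.apply_eq_iff_eq] at h
    exact hσ (perm_eq_one_of_strictAnti l α γ hα hγ σ (fun i => congrFun h i))
  · simp

theorem rename_alt (l : ℕ) (α : Fin l → ℕ) (σ : Equiv.Perm (Fin l)) :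
    rename σ (alt l α) = (Equiv.Perm.sign σ : ℤ) • alt l α := by
  rw [alt, AlgHom.map_det, zsmul_eq_mul]
  have := Matrix.det_permute σ
    (Matrix.of fun i j : Fin l => (X i : MvPolynomial (Fin l) ℤ) ^ α j)
  rw [← this]
  congr 1
  ext1 i j
  simp

theorem alternating_eq_zero (l : ℕ) (G : MvPolynomial (Fin l) ℤ)
    (hG : ∀ σ : Equiv.Perm (Fin l), rename σ G = (Equiv.Perm.sign σ : ℤ) • G)
    (h0 : ∀ γ : Fin l → ℕ, StrictAnti γ → coeff (Finsupp.equivFunOnFinite.symm γ) G = 0) :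
    G = 0 := by
  have key : ∀ (σ : Equiv.Perm (Fin l)) (γ : Fin l → ℕ),
      coeff (Finsupp.equivFunOnFinite.symm (fun i => γ (σ i))) G * Equiv.Perm.sign σ =
        coeff (Finsupp.equivFunOnFinite.symm γ) G := by
    intro σ γ
    rw [← coeff_rename_mapDomain σ σ.injective G, hG, coeff_smul, smul_eq_mul, mul_comm,
      ← mul_assoc, ← Units.val_mul, Int.units_mul_self, Units.val_one, one_mul]
    refine congrArg (fun d => coeff d G) ?_
    ext i
    rw [← Finsupp.equivMapDomain_eq_mapDomain, Finsupp.equivMapDomain_apply]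
    simp
  ext d
  obtain ⟨γ, rfl⟩ := Finsupp.equivFunOnFinite.symm.surjective d
  rw [coeff_zero]
  by_cases hinj : Function.Injective γ
  · have hs := Tuple.monotone_sort γ
    let τ : Equiv.Perm (Fin l) := Fin.revPerm.trans (Tuple.sort γ)
    have h := key τ γ
    rw [← h, h0, zero_mul]
    intro i j hij
    have h1 : γ (τ j) ≤ γ (τ i) := hs (Fin.rev_le_rev.2 hij.le)
    refine lt_of_le_of_ne h1 fun he => ?_
    exact hij.ne' (τ.injective (hinj he))
  · rw [Function.Injective] at hinj
    push Not at hinj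
    obtain ⟨a, b, hab, hne⟩ := hinj
    have h := key (Equiv.swap a b) γ
    have e : (fun i => γ (Equiv.swap a b i)) = γ := by
      ext i
      rw [Equiv.swap_apply_def]
      split_ifs with h1 h2
      · rw [h1, hab]
      · rw [h2, hab]
      · rfl
    rw [e, Equiv.Perm.sign_swap hne] at h
    simp at h
    omega

theorem strictAnti_add_delta (l : ℕ) (C : Fin l → ℕ) (hC : Antitone C) :
    StrictAnti (fun j : Fin l => C j + (l - 1 - (j : ℕ))) := by
  intro i j hij
  have h1 := hC hij.le
  have h2 : (i : ℕ) < j := hij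
  have := j.2
  simp only
  omega

theorem exists_of_strictAnti (l : ℕ) (γ : Fin l → ℕ) (hγ : StrictAnti γ) :
    ∃ C : Fin l → ℕ, Antitone C ∧ γ = fun j : Fin l => C j + (l - 1 - (j : ℕ)) := by
  have h1 : ∀ (k : ℕ) (i j : Fin l), (j : ℕ) = i + k → γ j + k ≤ γ i := by
    intro k
    induction k with
    | zero => intro i j h; have : j = i := Fin.ext h; simp [this]
    | succ k ih =>
      intro i j h
      have := j.2
      have h2 := ih i ⟨i + k, by omega⟩ rfl
      have h3 : γ j < γ ⟨i + k, by omega⟩ := hγ (by rw [Fin.lt_def]; simp; omega)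
      omega
  have h2 : ∀ i : Fin l, l - 1 - (i : ℕ) ≤ γ i := by
    intro i
    have := i.2
    have := h1 (l - 1 - (i : ℕ)) i ⟨l - 1, by omega⟩ (by simp; omega)
    omega
  refine ⟨fun j => γ j - (l - 1 - (j : ℕ)), ?_, ?_⟩
  · intro i j hij
    have h3 : (i : ℕ) ≤ j := hij
    have := h1 (j - i) i j (by omega)
    have := h2 i
    have := h2 j
    have := j.2
    simp only
    omega
  · ext j
    have := h2 j
    simp only
    omega

theorem vdm_coeff (l : ℕ) :
    coeff (Finsupp.equivFunOnFinite.symm fun j : Fin l => l - 1 - (j : ℕ)) (vdm l) = 1 := by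
  have h := strictAnti_add_delta l (fun _ => 0) antitone_const
  simp only [zero_add] at h
  rw [vdm_eq_alt, coeff_alt l _ _ h h, if_pos rfl]

theorem vdm_ne_zero (l : ℕ) : vdm l ≠ 0 := by
  intro h
  have := vdm_coeff l
  rw [h] at this
  simp at this

theorem degreeOf_alt_le (l : ℕ) (α : Fin l → ℕ) (N : ℕ) (h : ∀ i, α i ≤ N) (i : Fin l) :
    degreeOf i (alt l α) ≤ N := by
  rw [degreeOf_le_iff]
  intro d hd
  rw [mem_support_iff, alt_expand, coeff_sum] at hd
  obtain ⟨σ, _, hσ⟩ := Finset.exists_ne_zero_of_sum_ne_zero hd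
  rw [coeff_smul, coeff_monomial] at hσ
  split_ifs at hσ with hs
  · rw [← hs]
    exact h _
  · simp at hσ

/-- Expansion of `s_A s_B a_δ` in alternants. -/
theorem lr_expand (l m n : ℕ) (hl : 0 < l) (A B : Fin l → ℕ)
    (hAm : ∀ i, A i ≤ m) (hBn : ∀ i, B i ≤ n) [DecidablePred (Antitone : (Fin l → ℕ) → Prop)] :
    schur l A * schur l B * vdm l =
      ∑ c : Fin l → Fin (m + n + 1),
        if Antitone (fun i => (c i : ℕ)) then
          lrCoeff l A B (fun i => (c i : ℕ)) • alt l (fun j => (c j : ℕ) + (l - 1 - (j : ℕ)))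
        else 0 := by
  set F := schur l A * schur l B * vdm l with hF
  have hFv : F * vdm l = alt l (fun j => A j + (l - 1 - (j : ℕ))) *
      alt l (fun j => B j + (l - 1 - (j : ℕ))) := by
    rw [← schur_mul_vdm, ← schur_mul_vdm, hF]
    ring
  have hlr : ∀ C, lrCoeff l A B C = coeff (Finsupp.equivFunOnFinite.symm
      fun i : Fin l => C i + (l - 1 - (i : ℕ))) F := fun _ => rfl
  clear_value F
  have hdeg : degreeOf ⟨0, hl⟩ F ≤ m + n + (l - 1) := by
    by_cases hF0 : F = 0
    · rw [hF0]; simp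
    have h1 := degreeOf_mul_eq (n := (⟨0, hl⟩ : Fin l)) hF0 (vdm_ne_zero l)
    rw [hFv] at h1
    have h2 := degreeOf_mul_le (⟨0, hl⟩ : Fin l) (alt l (fun j => A j + (l - 1 - (j : ℕ))))
      (alt l (fun j => B j + (l - 1 - (j : ℕ))))
    have h3 := degreeOf_alt_le l (fun j => A j + (l - 1 - (j : ℕ))) (m + (l - 1))
      (fun i => by have := hAm i; omega) ⟨0, hl⟩
    have h4 := degreeOf_alt_le l (fun j => B j + (l - 1 - (j : ℕ))) (n + (l - 1))
      (fun i => by have := hBn i; omega) ⟨0, hl⟩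
    have h5 : l - 1 ≤ degreeOf ⟨0, hl⟩ (vdm l) := by
      have := monomial_le_degreeOf (⟨0, hl⟩ : Fin l) (f := vdm l)
        (m := Finsupp.equivFunOnFinite.symm fun j : Fin l => l - 1 - (j : ℕ))
        (by rw [mem_support_iff, vdm_coeff]; exact one_ne_zero)
      simpa using this
    omega
  have hFalt : ∀ σ : Equiv.Perm (Fin l), rename σ F = (Equiv.Perm.sign σ : ℤ) • F := by
    intro σ
    have h := congrArg (rename σ) hFv
    rw [map_mul, map_mul, rename_alt, rename_alt, vdm_eq_alt, rename_alt, ← vdm_eq_alt,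
      smul_mul_smul_comm, ← hFv, mul_smul_comm, ← smul_mul_assoc] at h
    have hs : ((Equiv.Perm.sign σ : ℤˣ) : ℤ) * (Equiv.Perm.sign σ : ℤˣ) = 1 := by
      rw [← Units.val_mul, Int.units_mul_self, Units.val_one]
    rw [hs, one_smul] at h
    have h' := mul_right_cancel₀ (vdm_ne_zero l) h
    conv_rhs => rw [← h', smul_smul, hs, one_smul]
  rw [← sub_eq_zero]
  apply alternating_eq_zero
  · intro σ
    rw [map_sub, smul_sub, hFalt, map_sum, Finset.smul_sum]
    congr 1
    refine Finset.sum_congr rfl fun c _ => ?_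
    split_ifs
    · rw [map_zsmul, rename_alt, smul_comm]
    · simp
  · intro γ hγ
    obtain ⟨C, hC, rfl⟩ := exists_of_strictAnti l γ hγ
    rw [coeff_sub, sub_eq_zero, coeff_sum]
    by_cases hb : C ⟨0, hl⟩ ≤ m + n
    · have hb' : ∀ i, C i < m + n + 1 := fun i =>
        Nat.lt_succ_of_le ((hC (Fin.mk_le_of_le_val (Nat.zero_le _))).trans hb)
      rw [Finset.sum_eq_single (fun i => ⟨C i, hb' i⟩)]
      · rw [if_pos hC, coeff_smul, coeff_alt l _ _ hγ hγ, if_pos rfl]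
        rw [hlr, smul_eq_mul, mul_one]
      · intro c _ hc
        split_ifs with hca
        · rw [coeff_smul, coeff_alt l _ _ (strictAnti_add_delta l _ hca) hγ, if_neg, smul_zero]
          intro h
          apply hc
          ext i
          have := congrFun h i
          simpa using this
        · simp
      · simp
    · rw [Finset.sum_eq_zero]
      · by_contra hne
        have := monomial_le_degreeOf (⟨0, hl⟩ : Fin l) (mem_support_iff.2 hne)
        simp at this
        omega
      · intro c _
        split_ifs with hca
        · rw [coeff_smul, coeff_alt l _ _ (strictAnti_add_delta l _ hca) hγ, if_neg, smul_zero]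
          intro h
          have := congrFun h ⟨0, hl⟩
          have := (c ⟨0, hl⟩).2
          simp at *
          omega
        · simp

/-- The inversion `x_i ↦ x_i⁻¹` into the fraction field. -/
noncomputable def invHom (l : ℕ) :
    MvPolynomial (Fin l) ℤ →+* FractionRing (MvPolynomial (Fin l) ℤ) :=
  eval₂Hom (Int.castRingHom _) fun i =>
    (algebraMap (MvPolynomial (Fin l) ℤ) (FractionRing (MvPolynomial (Fin l) ℤ)) (X i))⁻¹

/-- The product of all the variables in the fraction field. -/
noncomputable def xprod (l : ℕ) : FractionRing (MvPolynomial (Fin l) ℤ) :=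
  ∏ i : Fin l, algebraMap (MvPolynomial (Fin l) ℤ) (FractionRing (MvPolynomial (Fin l) ℤ)) (X i)

theorem algMap_X_ne_zero (l : ℕ) (i : Fin l) :
    algebraMap (MvPolynomial (Fin l) ℤ) (FractionRing (MvPolynomial (Fin l) ℤ)) (X i) ≠ 0 := by
  rw [Ne, FaithfulSMul.algebraMap_eq_zero_iff]
  exact X_ne_zero i

theorem invHom_alt (l N : ℕ) (α : Fin l → ℕ) (h : ∀ i, α i ≤ N) :
    xprod l ^ N * invHom l (alt l α) =
      algebraMap (MvPolynomial (Fin l) ℤ) (FractionRing (MvPolynomial (Fin l) ℤ)) (alt l fun j => N - α j) := by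
  rw [alt, alt, RingHom.map_det, RingHom.map_det, xprod, ← Finset.prod_pow, ← Matrix.det_mul_column]
  congr 1
  ext1 i j
  have h0 := algMap_X_ne_zero l i
  simp only [invHom, Matrix.map_apply, Matrix.of_apply, map_pow, eval₂Hom_X',
    RingHom.mapMatrix_apply]
  rw [pow_sub₀ _ h0 (h j), inv_pow]

theorem alt_rev (l : ℕ) (α : Fin l → ℕ) :
    alt l (fun j => α (Fin.rev j)) =
      ((Equiv.Perm.sign (Fin.revPerm : Equiv.Perm (Fin l)) : ℤˣ) : ℤ) • alt l α := by
  rw [alt, alt, zsmul_eq_mul]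
  exact Matrix.det_permute' Fin.revPerm
    (Matrix.of fun i j : Fin l => (X i : MvPolynomial (Fin l) ℤ) ^ α j)

theorem invHom_alt_delta (l m : ℕ) (A : Fin l → ℕ) (h : ∀ i, A i ≤ m) :
    xprod l ^ (m + (l - 1)) * invHom l (alt l fun j => A j + (l - 1 - (j : ℕ))) =
      (((Equiv.Perm.sign (Fin.revPerm : Equiv.Perm (Fin l)) : ℤˣ) : ℤ) :
        FractionRing (MvPolynomial (Fin l) ℤ)) *
      algebraMap (MvPolynomial (Fin l) ℤ) (FractionRing (MvPolynomial (Fin l) ℤ))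
        (alt l fun j => (m - A (Fin.rev j)) + (l - 1 - (j : ℕ))) := by
  rw [invHom_alt l (m + (l - 1)) _ (fun i => by have := h i; omega), ← zsmul_eq_mul,
    ← map_zsmul, ← alt_rev]
  congr 2
  ext j
  have := h j
  have := j.2
  simp only [Fin.rev_rev, Fin.val_rev]
  omega

open Classical in
/-- For positive integers `l`, `m`, `n` and partitions `A`, `B` of
length at most `l` with `a_1 ≤ m` and `b_1 ≤ n`, the tuples
`mD + χ(A) = (m - a_l, …, m - a_1)` and `nD + χ(B)` are partitions, and
`s_{mD+χ(A)} · s_{nD+χ(B)} = Σ_C c^C_{A,B} s_{(m+n)D+χ(C)}` in `l` variables, the sum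
over partitions `C` of length at most `l` with `c_1 ≤ m + n`. -/
theorem schur_chi_mul (l m n : ℕ) (hl : 0 < l) (hm : 0 < m) (hn : 0 < n)
    (A B : Fin l → ℕ) (hA : Antitone A) (hB : Antitone B)
    (hAm : ∀ i, A i ≤ m) (hBn : ∀ i, B i ≤ n) :
    Antitone (fun i => m - A (Fin.rev i)) ∧ Antitone (fun i => n - B (Fin.rev i)) ∧
    schur l (fun i => m - A (Fin.rev i)) * schur l (fun i => n - B (Fin.rev i)) =
      ∑ c : Fin l → Fin (m + n + 1),
        if Antitone (fun i => (c i : ℕ)) then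
          lrCoeff l A B (fun i => (c i : ℕ)) •
            schur l (fun i => (m + n) - (c (Fin.rev i) : ℕ))
        else 0 := by

  refine ⟨?_, ?_, ?_⟩
  · intro i j hij
    have := hA (Fin.rev_le_rev.2 hij)
    simp only
    omega
  · intro i j hij
    have := hB (Fin.rev_le_rev.2 hij)
    simp only
    omega
  have hs : ((Equiv.Perm.sign (Fin.revPerm : Equiv.Perm (Fin l)) : ℤˣ) : ℤ) *
      (Equiv.Perm.sign (Fin.revPerm : Equiv.Perm (Fin l)) : ℤˣ) = 1 := by
    rw [← Units.val_mul, Int.units_mul_self, Units.val_one]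
  have hs' := congrArg (Int.cast : ℤ → FractionRing (MvPolynomial (Fin l) ℤ)) hs
  rw [Int.cast_mul, Int.cast_one] at hs'
  have hexp := lr_expand l m n hl A B hAm hBn
  have h1 : alt l (fun j => A j + (l - 1 - (j : ℕ))) * alt l (fun j => B j + (l - 1 - (j : ℕ))) =
      (schur l A * schur l B * vdm l) * vdm l := by
    rw [← schur_mul_vdm, ← schur_mul_vdm]
    ring
  rw [hexp] at h1
  have hv := invHom_alt_delta l 0 (fun _ => 0) (fun _ => le_rfl)
  simp only [zero_add, Nat.sub_zero] at hv
  rw [← vdm_eq_alt] at hv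
  have h2 := congrArg (fun P => (xprod l ^ (m + (l - 1)) * xprod l ^ (n + (l - 1))) *
    invHom l P) h1
  simp only [map_mul] at h2
  rw [mul_mul_mul_comm, invHom_alt_delta l m A hAm, invHom_alt_delta l n B hBn,
    ← pow_add, show m + (l - 1) + (n + (l - 1)) = (m + n + (l - 1)) + (l - 1) by omega,
    pow_add, mul_mul_mul_comm (xprod l ^ (m + n + (l - 1))), hv, map_sum, Finset.mul_sum] at h2
  have h3 : ∀ c : Fin l → Fin (m + n + 1),
      xprod l ^ (m + n + (l - 1)) * invHom l (if Antitone (fun i => (c i : ℕ)) then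
          lrCoeff l A B (fun i => (c i : ℕ)) • alt l (fun j => (c j : ℕ) + (l - 1 - (j : ℕ)))
        else 0) =
      (((Equiv.Perm.sign (Fin.revPerm : Equiv.Perm (Fin l)) : ℤˣ) : ℤ) :
        FractionRing (MvPolynomial (Fin l) ℤ)) *
      algebraMap (MvPolynomial (Fin l) ℤ) (FractionRing (MvPolynomial (Fin l) ℤ))
       ((if Antitone (fun i => (c i : ℕ)) then
          lrCoeff l A B (fun i => (c i : ℕ)) •
            schur l (fun i => (m + n) - (c (Fin.rev i) : ℕ))
        else 0) * vdm l) := by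
    intro c
    split_ifs
    · rw [zsmul_eq_mul, zsmul_eq_mul, map_mul, map_intCast, mul_left_comm, invHom_alt_delta l (m + n) (fun i => (c i : ℕ))
        (fun i => Nat.lt_succ_iff.1 (c i).2), mul_assoc, schur_mul_vdm, map_mul, map_intCast,
        mul_left_comm]
    · simp
  rw [Finset.sum_congr rfl (fun c _ => h3 c), ← Finset.mul_sum, 
    mul_mul_mul_comm (Int.cast _), hs', one_mul,
    mul_mul_mul_comm (Int.cast _), hs', one_mul, ← map_sum, ← map_mul, ← map_mul,
    ← Finset.sum_mul, ← schur_mul_vdm, ← schur_mul_vdm] at h2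
  have h4 := FaithfulSMul.algebraMap_injective _ _ h2
  have hv0 := vdm_ne_zero l
  apply mul_right_cancel₀ (mul_ne_zero hv0 hv0)
  linear_combination h4
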